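/- arXiv:2412.18297 — 4 statements merged into one kernel-verified Lean document; each statement's English description precedes it below -/
import Mathlib

section
/- A CSP assignment Φ = (φ_1,…,φ_k) ∈ (Δ_{mn})^k is the CSP assignment of some valid menu iff each φ_i ∈ C(Φ) and C(Φ) is response-satisfiable. Precisely: there exists a closed convex response-satisfiable set M ⊆ Δ_{mn} such that for every i ∈ [k], φ_i ∈ M and u_{O,i}(φ_i) = sup_{φ ∈ M} u_{O,i}(φ), if and only if (1) φ_i ∈ C(Φ) for all i ∈ [k], and (2) C(Φ) is response-satisfiable. Moreover, when these conditions hold, M = C(Φ) itself is such a set. -/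
open scoped BigOperators

noncomputable section

/-- Linear extension of a payoff function to CSPs. -/
def lin {m n : ℕ} (u : Fin m × Fin n → ℝ) (φ : Fin m × Fin n → ℝ) : ℝ :=
  ∑ p : Fin m × Fin n, φ p * u p

/-- The product distribution `x ⊗ y`. -/
def prodCSP {m n : ℕ} (x : Fin m → ℝ) (y : Fin n → ℝ) : Fin m × Fin n → ℝ :=
  fun p => x p.1 * y p.2

/-- A set of CSPs is response-satisfiable. -/
def ResponseSatisfiable {m n : ℕ} (M : Set (Fin m × Fin n → ℝ)) : Prop :=
  ∀ y ∈ stdSimplex ℝ (Fin n), ∃ x ∈ stdSimplex ℝ (Fin m), prodCSP x y ∈ M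

/-- The candidate menu `C(Φ)` of a CSP assignment `Φ` (ε = 0 specialization). -/
def candidateMenu {m n k : ℕ} (uO : Fin k → Fin m × Fin n → ℝ)
    (Φ : Fin k → Fin m × Fin n → ℝ) : Set (Fin m × Fin n → ℝ) :=
  {φ ∈ stdSimplex ℝ (Fin m × Fin n) | ∀ i, lin (uO i) φ ≤ lin (uO i) (Φ i)}

theorem continuous_lin {m n : ℕ} (u : Fin m × Fin n → ℝ) : Continuous (lin u) := by
  unfold lin
  fun_prop

theorem lin_combo {m n : ℕ} (u φ ψ : Fin m × Fin n → ℝ) (a b : ℝ) :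
    lin u (a • φ + b • ψ) = a * lin u φ + b * lin u ψ := by
  simp only [lin, Pi.add_apply, Pi.smul_apply, smul_eq_mul, Finset.mul_sum,
    ← Finset.sum_add_distrib]
  exact Finset.sum_congr rfl fun _ _ => by ring

theorem bddAbove_lin_image {m n : ℕ} (u : Fin m × Fin n → ℝ)
    {M : Set (Fin m × Fin n → ℝ)} (hM : M ⊆ stdSimplex ℝ (Fin m × Fin n)) :
    BddAbove (lin u '' M) :=
  ((isCompact_stdSimplex ℝ (Fin m × Fin n)).bddAbove_image
    (continuous_lin u).continuousOn).mono (Set.image_mono hM)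

theorem candidateMenu_subset {m n k : ℕ} (uO : Fin k → Fin m × Fin n → ℝ)
    (Φ : Fin k → Fin m × Fin n → ℝ) :
    candidateMenu uO Φ ⊆ stdSimplex ℝ (Fin m × Fin n) :=
  fun _ h => h.1

theorem isClosed_candidateMenu {m n k : ℕ} (uO : Fin k → Fin m × Fin n → ℝ)
    (Φ : Fin k → Fin m × Fin n → ℝ) : IsClosed (candidateMenu uO Φ) := by
  have h : IsClosed {φ | ∀ i, lin (uO i) φ ≤ lin (uO i) (Φ i)} :=
    isClosed_le (continuous_pi fun i => continuous_lin (uO i)) continuous_const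
  exact (isClosed_stdSimplex ℝ (Fin m × Fin n)).inter h

theorem convex_candidateMenu {m n k : ℕ} (uO : Fin k → Fin m × Fin n → ℝ)
    (Φ : Fin k → Fin m × Fin n → ℝ) : Convex ℝ (candidateMenu uO Φ) := by
  intro φ hφ ψ hψ a b ha hb hab
  refine ⟨convex_stdSimplex ℝ _ hφ.1 hψ.1 ha hb hab, fun i => ?_⟩
  rw [lin_combo]
  calc a * lin (uO i) φ + b * lin (uO i) ψ
      ≤ a * lin (uO i) (Φ i) + b * lin (uO i) (Φ i) := by
        gcongr
        exacts [hφ.2 i, hψ.2 i]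
    _ = lin (uO i) (Φ i) := by rw [← add_mul, hab, one_mul]

theorem lin_eq_sSup_candidateMenu {m n k : ℕ} (uO : Fin k → Fin m × Fin n → ℝ)
    (Φ : Fin k → Fin m × Fin n → ℝ) (i : Fin k) (hi : Φ i ∈ candidateMenu uO Φ) :
    lin (uO i) (Φ i) = sSup (lin (uO i) '' candidateMenu uO Φ) := by
  have h : IsGreatest (lin (uO i) '' candidateMenu uO Φ) (lin (uO i) (Φ i)) :=
    ⟨Set.mem_image_of_mem _ hi, Set.forall_mem_image.2 fun _ hφ => hφ.2 i⟩
  exact h.csSup_eq.symm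

/-- Every menu whose maximizers are `Φ` lies inside the candidate menu. -/
theorem subset_candidateMenu {m n k : ℕ} (uO : Fin k → Fin m × Fin n → ℝ)
    (Φ : Fin k → Fin m × Fin n → ℝ) {M : Set (Fin m × Fin n → ℝ)}
    (hM : M ⊆ stdSimplex ℝ (Fin m × Fin n))
    (hsup : ∀ i, lin (uO i) (Φ i) = sSup (lin (uO i) '' M)) :
    M ⊆ candidateMenu uO Φ := fun _ hφ =>
  ⟨hM hφ, fun i => (le_csSup (bddAbove_lin_image (uO i) hM)
    (Set.mem_image_of_mem _ hφ)).trans_eq (hsup i).symm⟩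

/-- `Φ` is the CSP assignment of some valid menu (closed convex
response-satisfiable `M ⊆ Δ_{mn}` in which each `φ_i` maximizes `u_{O,i}`) iff
each `φ_i ∈ C(Φ)` and `C(Φ)` is response-satisfiable; moreover in that case
`C(Φ)` itself is such a set. -/
theorem csp_assignment_characterization {m n k : ℕ}
    (hm : 0 < m) (hn : 0 < n) (hk : 0 < k)
    (uO : Fin k → Fin m × Fin n → ℝ)
    (Φ : Fin k → Fin m × Fin n → ℝ)
    (hΦ : ∀ i, Φ i ∈ stdSimplex ℝ (Fin m × Fin n)) :
    ((∃ M : Set (Fin m × Fin n → ℝ),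
        IsClosed M ∧ Convex ℝ M ∧ M ⊆ stdSimplex ℝ (Fin m × Fin n) ∧
        ResponseSatisfiable M ∧
        ∀ i, Φ i ∈ M ∧ lin (uO i) (Φ i) = sSup (lin (uO i) '' M)) ↔
      ((∀ i, Φ i ∈ candidateMenu uO Φ) ∧ ResponseSatisfiable (candidateMenu uO Φ)))
    ∧ (((∀ i, Φ i ∈ candidateMenu uO Φ) ∧ ResponseSatisfiable (candidateMenu uO Φ)) →
        (IsClosed (candidateMenu uO Φ) ∧ Convex ℝ (candidateMenu uO Φ) ∧
          candidateMenu uO Φ ⊆ stdSimplex ℝ (Fin m × Fin n) ∧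
          ResponseSatisfiable (candidateMenu uO Φ) ∧
          ∀ i, Φ i ∈ candidateMenu uO Φ ∧
            lin (uO i) (Φ i) = sSup (lin (uO i) '' candidateMenu uO Φ))) := by
  have menu : ((∀ i, Φ i ∈ candidateMenu uO Φ) ∧ ResponseSatisfiable (candidateMenu uO Φ)) →
      (IsClosed (candidateMenu uO Φ) ∧ Convex ℝ (candidateMenu uO Φ) ∧
        candidateMenu uO Φ ⊆ stdSimplex ℝ (Fin m × Fin n) ∧
        ResponseSatisfiable (candidateMenu uO Φ) ∧
        ∀ i, Φ i ∈ candidateMenu uO Φ ∧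
          lin (uO i) (Φ i) = sSup (lin (uO i) '' candidateMenu uO Φ)) := fun h =>
    ⟨isClosed_candidateMenu uO Φ, convex_candidateMenu uO Φ, candidateMenu_subset uO Φ, h.2,
      fun i => ⟨h.1 i, lin_eq_sSup_candidateMenu uO Φ i (h.1 i)⟩⟩
  refine ⟨⟨?_, fun h => ⟨_, menu h⟩⟩, menu⟩
  rintro ⟨M, -, -, hM, hresp, hmax⟩
  have hsub := subset_candidateMenu uO Φ hM fun i => (hmax i).2
  refine ⟨fun i => hsub (hmax i).1, fun y hy => ?_⟩
  obtain ⟨x, hx, hxy⟩ := hresp y hy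
  exact ⟨x, hx, hsub hxy⟩
end
end

section
/- Suppose y* ∈ Δ_n is such that x⊗y* ∉ C(Φ) for every x ∈ Δ_m. Then there exists h ∈ ℝ^k with h_i ≥ 0 for all i such that Σ_{i∈[k]} h_i u_{O,i}(φ) ≤ Σ_{i∈[k]} h_i u_{O,i}(φ_i) for every φ ∈ C(Φ), while Σ_{i∈[k]} h_i u_{O,i}(x⊗y*) > Σ_{i∈[k]} h_i u_{O,i}(φ_i) for every x ∈ Δ_m. -/
open scoped BigOperators

noncomputable section

/-- A compact convex set of vectors none of
which is coordinatewise at most `b` is strictly separated from `b` by a nonnegative weighting. -/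
theorem exists_nonneg_forall_sum_mul_lt {ι : Type*} [Fintype ι] {S : Set (ι → ℝ)}
    (hconv : Convex ℝ S) (hcomp : IsCompact S) (b : ι → ℝ) (hS : ∀ s ∈ S, ¬ s ≤ b) :
    ∃ h : ι → ℝ, (∀ i, 0 ≤ h i) ∧ ∀ s ∈ S, ∑ i, h i * b i < ∑ i, h i * s i := by
  classical
  obtain ⟨f, u, v, hu, huv, hv⟩ := geometric_hahn_banach_closed_compact (convex_Iic (𝕜 := ℝ) b)
    isClosed_Iic hconv hcomp (Set.disjoint_left.2 fun s hb hs => hS s hs hb)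
  have hf (z : ι → ℝ) : ∑ i, f (Pi.single i 1) * z i = f z := by
    conv_rhs => rw [pi_eq_sum_univ' z, map_sum]
    refine Finset.sum_congr rfl fun i _ => ?_
    rw [map_smul, smul_eq_mul, mul_comm]
  refine ⟨fun i => f (Pi.single i 1), fun i => ?_, fun s hs => ?_⟩
  · by_contra! hneg
    set c := f (Pi.single i 1)
    have hb : f b < u := hu b Set.self_mem_Iic
    have hpos : 0 < (u - f b) / (-c) := div_pos (by linarith) (by linarith)
    have hle : b - ((u - f b) / (-c)) • Pi.single i (1 : ℝ) ≤ b := by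
      refine sub_le_self _ (smul_nonneg hpos.le ?_)
      exact Pi.single_nonneg.2 zero_le_one
    have hlt := hu _ hle
    rw [map_sub, map_smul, smul_eq_mul] at hlt
    have hmul : (u - f b) / (-c) * c = -(u - f b) := by
      rw [div_neg, neg_mul, div_mul_cancel₀ _ hneg.ne]
    change f b - (u - f b) / (-c) * c < u at hlt
    linarith
  · simp only [hf]
    exact (hu b Set.self_mem_Iic).trans (huv.trans (hv s hs))

/-- The product of two mixed strategies is a correlated strategy profile. -/
theorem prodCSP_mem_stdSimplex {m n : ℕ} {x : Fin m → ℝ} {y : Fin n → ℝ}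
    (hx : x ∈ stdSimplex ℝ (Fin m)) (hy : y ∈ stdSimplex ℝ (Fin n)) :
    prodCSP x y ∈ stdSimplex ℝ (Fin m × Fin n) := by
  refine ⟨fun p => mul_nonneg (hx.1 _) (hy.1 _), ?_⟩
  simp only [prodCSP]
  rw [Fintype.sum_prod_type, ← Fintype.sum_mul_sum, hx.2, hy.2, one_mul]

/-- The vector of payoffs at `x ⊗ y`, as a linear function of `x`. -/
def payoffMap {m n k : ℕ} (u : Fin k → Fin m × Fin n → ℝ) (y : Fin n → ℝ) :
    (Fin m → ℝ) →ₗ[ℝ] (Fin k → ℝ) where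
  toFun x i := lin (u i) (prodCSP x y)
  map_add' x x' := by
    ext i
    simp [lin, prodCSP, add_mul, Finset.sum_add_distrib]
  map_smul' c x := by
    ext i
    simp [lin, prodCSP, Finset.mul_sum, mul_assoc]

/-- if `x ⊗ y* ∉ C(Φ)` for every `x ∈ Δ_m`, then there is a
nonnegative combination `h` of the optimizer payoffs such that
`Σ_i h_i u_{O,i}(·)` is at most `Σ_i h_i u_{O,i}(φ_i)` on `C(Φ)` but strictly
exceeds it at `x ⊗ y*` for every `x ∈ Δ_m`. -/
theorem separating_hyperplane_exists {m n k : ℕ}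
    (hm : 0 < m) (hn : 0 < n) (hk : 0 < k)
    (uO : Fin k → Fin m × Fin n → ℝ)
    (Φ : Fin k → Fin m × Fin n → ℝ)
    (hΦ : ∀ i, Φ i ∈ stdSimplex ℝ (Fin m × Fin n))
    (ystar : Fin n → ℝ) (hy : ystar ∈ stdSimplex ℝ (Fin n))
    (hmiss : ∀ x ∈ stdSimplex ℝ (Fin m), prodCSP x ystar ∉ candidateMenu uO Φ) :
    ∃ h : Fin k → ℝ, (∀ i, 0 ≤ h i) ∧
      (∀ φ ∈ candidateMenu uO Φ,
        ∑ i, h i * lin (uO i) φ ≤ ∑ i, h i * lin (uO i) (Φ i)) ∧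
      (∀ x ∈ stdSimplex ℝ (Fin m),
        ∑ i, h i * lin (uO i) (Φ i) < ∑ i, h i * lin (uO i) (prodCSP x ystar)) := by
  obtain ⟨h, h0, hlt⟩ := exists_nonneg_forall_sum_mul_lt
    (S := payoffMap uO ystar '' stdSimplex ℝ (Fin m))
    ((convex_stdSimplex ℝ (Fin m)).linear_image _)
    ((isCompact_stdSimplex ℝ (Fin m)).image (payoffMap uO ystar).continuous_of_finiteDimensional)
    (fun i => lin (uO i) (Φ i))
    (by
      rintro _ ⟨x, hx, rfl⟩ hle
      exact hmiss x hx ⟨prodCSP_mem_stdSimplex hx hy, hle⟩)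
  exact ⟨h, h0,
    fun φ hφ => Finset.sum_le_sum fun i _ => mul_le_mul_of_nonneg_left (hφ.2 i) (h0 i),
    fun x hx => hlt _ ⟨x, hx, rfl⟩⟩
end
end

section
/- (Maximin guarantee from a sandwiched menu.) Fix a learner payoff u_L and V ∈ ℝ, let F(V) = {φ ∈ Δ_{mn} : u_L(φ) ≥ V} be nonempty, and for each i ∈ [k] let φ_i ∈ F(V) satisfy u_{O,i}(φ_i) = sup_{φ∈F(V)} u_{O,i}(φ); set Φ = (φ_1,…,φ_k). Let M ⊆ Δ_{mn} be any closed set such that M ⊆ C(Φ) and φ_i ∈ M for all i ∈ [k]. Then for every i ∈ [k], V_L(M, u_{O,i}) ≥ V; that is, min_{i∈[k]} V_L(M, u_{O,i}) ≥ V. -/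
open scoped BigOperators

noncomputable section

/-- The level set `F(V) = {φ ∈ Δ_{mn} : u_L(φ) ≥ V}`. -/
def levelSet {m n : ℕ} (uL : Fin m × Fin n → ℝ) (V : ℝ) :
    Set (Fin m × Fin n → ℝ) :=
  {φ ∈ stdSimplex ℝ (Fin m × Fin n) | V ≤ lin uL φ}

/-- `V_L(M, uO)`: the learner's value when the optimizer picks its
utility-maximizing CSP from `M`, breaking ties in the learner's favor. -/
def learnerVal {m n : ℕ} (uL uO : Fin m × Fin n → ℝ)
    (M : Set (Fin m × Fin n → ℝ)) : ℝ :=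
  sSup (lin uL '' {φ ∈ M | lin uO φ = sSup (lin uO '' M)})

theorem bddAbove_lin_image_stdSimplex {m n : ℕ} (u : Fin m × Fin n → ℝ) :
    BddAbove (lin u '' stdSimplex ℝ (Fin m × Fin n)) :=
  ((isCompact_stdSimplex ℝ _).image (continuous_lin u)).bddAbove

/-- maximin guarantee from a sandwiched menu: if `F(V)` is
nonempty, `Φ` assigns each type its `u_{O,i}`-optimal CSP in `F(V)`, and the
closed set `M` satisfies `M ⊆ C(Φ)` and `φ_i ∈ M` for all `i`, then
`V_L(M, u_{O,i}) ≥ V` for every `i`. -/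
theorem maximin_guarantee {m n k : ℕ}
    (hm : 0 < m) (hn : 0 < n) (hk : 0 < k)
    (uL : Fin m × Fin n → ℝ) (uO : Fin k → Fin m × Fin n → ℝ) (V : ℝ)
    (hne : (levelSet uL V).Nonempty)
    (Φ : Fin k → Fin m × Fin n → ℝ)
    (hΦ : ∀ i, Φ i ∈ levelSet uL V)
    (hΦmax : ∀ i, lin (uO i) (Φ i) = sSup (lin (uO i) '' levelSet uL V))
    (M : Set (Fin m × Fin n → ℝ)) (hMcl : IsClosed M)
    (hMsub : M ⊆ candidateMenu uO Φ)
    (hΦM : ∀ i, Φ i ∈ M) :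
    ∀ i, V ≤ learnerVal uL (uO i) M := by
  intro i
  have hmax : IsGreatest (lin (uO i) '' M) (lin (uO i) (Φ i)) :=
    ⟨⟨Φ i, hΦM i, rfl⟩, by rintro _ ⟨φ, hφ, rfl⟩; exact (hMsub hφ).2 i⟩
  refine (hΦ i).2.trans (le_csSup ?_ ⟨Φ i, ⟨hΦM i, hmax.csSup_eq.symm⟩, rfl⟩)
  exact (bddAbove_lin_image_stdSimplex uL).mono
    (Set.image_mono fun φ hφ => (hMsub hφ.1).1)
end
end

section
/- (Exact characterization of the optimal general commitment value.) For any probability weights α ∈ Δ_k: the supremum over all closed convex response-satisfiable sets M ⊆ Δ_{mn} of Σ_{i∈[k]} α_i V_L(M, u_{O,i}) equals the maximum of Σ_{i∈[k]} α_i u_L(φ_i) over all CSP assignments Φ = (φ_1,…,φ_k) ∈ (Δ_{mn})^k such that φ_i ∈ C(Φ) for all i ∈ [k] and C(Φ) is response-satisfiable. Moreover this maximum is attained, and for a maximizer Φ* the supremum on the left is attained by the menu M = C(Φ*). -/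
open scoped BigOperators

noncomputable section

/-- Feasibility for the general (unconstrained) commitment problem: every type
gets its assigned CSP inside the candidate menu, and the candidate menu is
response-satisfiable (i.e. a valid menu). -/
def GCFeasible {m n k : ℕ} (uO : Fin k → Fin m × Fin n → ℝ)
    (Φ : Fin k → Fin m × Fin n → ℝ) : Prop :=
  (∀ i, Φ i ∈ candidateMenu uO Φ) ∧ ResponseSatisfiable (candidateMenu uO Φ)

theorem isClosed_setOf_forall {X : Type*} [TopologicalSpace X] {ι : Sort*} {p : ι → X → Prop}
    (h : ∀ i, IsClosed {x | p i x}) : IsClosed {x | ∀ i, p i x} := by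
  simpa only [Set.ofPred_forall] using isClosed_iInter h

theorem ResponseSatisfiable.nonempty {m n : ℕ} (hn : 0 < n) {M : Set (Fin m × Fin n → ℝ)}
    (hM : ResponseSatisfiable M) : M.Nonempty := by
  obtain ⟨x, -, hx⟩ := hM _ (single_mem_stdSimplex ℝ (⟨0, hn⟩ : Fin n))
  exact ⟨_, hx⟩

theorem responseSatisfiable_stdSimplex {m n : ℕ} (hm : 0 < m) :
    ResponseSatisfiable (stdSimplex ℝ (Fin m × Fin n)) := fun _ hy =>
  have hx := single_mem_stdSimplex ℝ (⟨0, hm⟩ : Fin m)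
  ⟨_, hx, prodCSP_mem_stdSimplex hx hy⟩

/-- The learner's value of a compact nonempty menu is attained at a CSP that is optimal for the
optimizer. -/
theorem exists_lin_eq_learnerVal {m n : ℕ} (uL uO : Fin m × Fin n → ℝ)
    {M : Set (Fin m × Fin n → ℝ)} (hM : IsCompact M) (hne : M.Nonempty) :
    ∃ φ ∈ M, (∀ ψ ∈ M, lin uO ψ ≤ lin uO φ) ∧ lin uL φ = learnerVal uL uO M := by
  obtain ⟨φ₀, hφ₀, hsup, hmax⟩ :=
    hM.exists_sSup_image_eq_and_ge hne (continuous_lin uO).continuousOn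
  have hc : IsCompact {φ ∈ M | lin uO φ = sSup (lin uO '' M)} :=
    hM.inter_right (isClosed_eq (continuous_lin uO) continuous_const)
  obtain ⟨φ, hφ, heq⟩ :=
    hc.exists_sSup_image_eq ⟨φ₀, hφ₀, hsup.symm⟩ (continuous_lin uL).continuousOn
  refine ⟨φ, hφ.1, fun ψ hψ => ?_, heq.symm⟩
  rw [hφ.2, hsup]
  exact hmax ψ hψ

theorem lin_le_learnerVal {m n : ℕ} (uL uO : Fin m × Fin n → ℝ)
    {M : Set (Fin m × Fin n → ℝ)} (hM : IsCompact M) {φ : Fin m × Fin n → ℝ} (hφ : φ ∈ M)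
    (hmax : ∀ ψ ∈ M, lin uO ψ ≤ lin uO φ) : lin uL φ ≤ learnerVal uL uO M := by
  refine le_csSup ?_ (Set.mem_image_of_mem _ ⟨hφ, ?_⟩)
  · exact (hM.image (continuous_lin uL)).bddAbove.mono (Set.image_mono (Set.sep_subset _ _))
  · refine (IsGreatest.csSup_eq ⟨Set.mem_image_of_mem _ hφ, ?_⟩).symm
    rintro _ ⟨ψ, hψ, rfl⟩
    exact hmax ψ hψ

/-- Every valid menu induces a feasible assignment realizing its values for all types. -/
theorem exists_gcFeasible_lin_eq_learnerVal {m n k : ℕ} (hn : 0 < n)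
    (uL : Fin m × Fin n → ℝ) (uO : Fin k → Fin m × Fin n → ℝ)
    {M : Set (Fin m × Fin n → ℝ)} (hcl : IsClosed M)
    (hsub : M ⊆ stdSimplex ℝ (Fin m × Fin n)) (hM : ResponseSatisfiable M) :
    ∃ Φ : Fin k → Fin m × Fin n → ℝ, GCFeasible uO Φ ∧
      ∀ i, lin uL (Φ i) = learnerVal uL (uO i) M := by
  have hc : IsCompact M := (isCompact_stdSimplex ℝ _).of_isClosed_subset hcl hsub
  choose Φ hΦ hmax heq using fun i => exists_lin_eq_learnerVal uL (uO i) hc (hM.nonempty hn)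
  have hMC : M ⊆ candidateMenu uO Φ := fun φ hφ => ⟨hsub hφ, fun i => hmax i φ hφ⟩
  refine ⟨Φ, ⟨fun i => hMC (hΦ i), fun y hy => ?_⟩, heq⟩
  obtain ⟨x, hx, hxy⟩ := hM y hy
  exact ⟨x, hx, hMC hxy⟩

theorem isClosed_setOf_responseSatisfiable_candidateMenu {m n k : ℕ}
    (uO : Fin k → Fin m × Fin n → ℝ) :
    IsClosed {Φ : Fin k → Fin m × Fin n → ℝ | ResponseSatisfiable (candidateMenu uO Φ)} := by
  refine isClosed_setOf_forall fun y => isClosed_setOf_forall fun hy => ?_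
  have : CompactSpace (stdSimplex ℝ (Fin m)) :=
    isCompact_iff_compactSpace.mp (isCompact_stdSimplex ℝ _)
  have hcl : IsClosed {p : (Fin k → Fin m × Fin n → ℝ) × stdSimplex ℝ (Fin m) |
      ∀ i, lin (uO i) (prodCSP p.2 y) ≤ lin (uO i) (p.1 i)} := by
    refine isClosed_setOf_forall fun i => isClosed_le ?_ ?_
    · refine (continuous_lin _).comp ?_
      exact continuous_pi fun q => (((continuous_apply q.1).comp
        (continuous_subtype_val.comp continuous_snd)).mul continuous_const)
    · exact (continuous_lin _).comp (by fun_prop)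
  convert isClosedMap_fst_of_compactSpace _ hcl using 1
  ext Φ
  constructor
  · rintro ⟨x, hx, hxy⟩
    exact ⟨(Φ, ⟨x, hx⟩), hxy.2, rfl⟩
  · rintro ⟨⟨_, x⟩, hx, rfl⟩
    exact ⟨x, x.2, prodCSP_mem_stdSimplex x.2 hy, hx⟩

theorem isCompact_setOf_gcFeasible {m n k : ℕ} (uO : Fin k → Fin m × Fin n → ℝ) :
    IsCompact {Φ | GCFeasible uO Φ} := by
  refine (isCompact_univ_pi fun _ : Fin k =>
    isCompact_stdSimplex ℝ (Fin m × Fin n)).of_isClosed_subset ?_ fun Φ hΦ i _ => (hΦ.1 i).1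
  refine IsClosed.inter (isClosed_setOf_forall fun i => IsClosed.inter ?_ ?_)
    (isClosed_setOf_responseSatisfiable_candidateMenu uO)
  · exact (isClosed_stdSimplex ℝ (Fin m × Fin n)).preimage
      (continuous_apply (A := fun _ : Fin k => Fin m × Fin n → ℝ) i)
  · exact isClosed_setOf_forall fun j => isClosed_le
      ((continuous_lin _).comp (continuous_apply i)) ((continuous_lin _).comp (continuous_apply j))

/-- exact characterization of the optimal general commitment
value: the supremum over all valid menus `M` of `Σ_i α_i V_L(M, u_{O,i})`
equals the maximum of `Σ_i α_i u_L(φ_i)` over all feasible CSP assignments;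
the maximum is attained, and for a maximizer `Φ*` the menu `C(Φ*)` attains
the supremum. -/
theorem optimal_general_commitment {m n k : ℕ}
    (hm : 0 < m) (hn : 0 < n) (hk : 0 < k)
    (uL : Fin m × Fin n → ℝ) (uO : Fin k → Fin m × Fin n → ℝ)
    (α : Fin k → ℝ) (hα : α ∈ stdSimplex ℝ (Fin k)) :
    ∃ Φstar : Fin k → Fin m × Fin n → ℝ,
      GCFeasible uO Φstar ∧
      (∀ Φ : Fin k → Fin m × Fin n → ℝ, GCFeasible uO Φ →
        ∑ i, α i * lin uL (Φ i) ≤ ∑ i, α i * lin uL (Φstar i)) ∧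
      sSup {r : ℝ | ∃ M : Set (Fin m × Fin n → ℝ),
          IsClosed M ∧ Convex ℝ M ∧ M ⊆ stdSimplex ℝ (Fin m × Fin n) ∧
          ResponseSatisfiable M ∧
          r = ∑ i, α i * learnerVal uL (uO i) M}
        = ∑ i, α i * lin uL (Φstar i) ∧
      ∑ i, α i * learnerVal uL (uO i) (candidateMenu uO Φstar)
        = ∑ i, α i * lin uL (Φstar i) := by
  obtain ⟨Φ₀, hΦ₀, -⟩ := exists_gcFeasible_lin_eq_learnerVal hn uL uO
    (isClosed_stdSimplex ℝ _) subset_rfl (responseSatisfiable_stdSimplex hm)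
  have hcont : Continuous fun Φ : Fin k → Fin m × Fin n → ℝ => ∑ i, α i * lin uL (Φ i) :=
    continuous_finsetSum _ fun i _ =>
      continuous_const.mul ((continuous_lin uL).comp (continuous_apply i))
  obtain ⟨Φ, hΦ, hmax⟩ :=
    (isCompact_setOf_gcFeasible uO).exists_isMaxOn ⟨Φ₀, hΦ₀⟩ hcont.continuousOn
  have hub : ∀ M : Set (Fin m × Fin n → ℝ), IsClosed M →
      M ⊆ stdSimplex ℝ (Fin m × Fin n) → ResponseSatisfiable M →
      ∑ i, α i * learnerVal uL (uO i) M ≤ ∑ i, α i * lin uL (Φ i) := by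
    intro M hcl hsub hM
    obtain ⟨Ψ, hΨ, heq⟩ := exists_gcFeasible_lin_eq_learnerVal hn uL uO hcl hsub hM
    simp only [← heq]
    exact hmax hΨ
  have hcl := isClosed_candidateMenu uO Φ
  have hsub : candidateMenu uO Φ ⊆ stdSimplex ℝ (Fin m × Fin n) := Set.sep_subset _ _
  have heq : ∑ i, α i * learnerVal uL (uO i) (candidateMenu uO Φ)
      = ∑ i, α i * lin uL (Φ i) := by
    refine (hub _ hcl hsub hΦ.2).antisymm (Finset.sum_le_sum fun i _ => ?_)
    refine mul_le_mul_of_nonneg_left ?_ (hα.1 i)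
    exact lin_le_learnerVal uL (uO i) ((isCompact_stdSimplex ℝ _).of_isClosed_subset hcl hsub)
      (hΦ.1 i) fun ψ hψ => hψ.2 i
  refine ⟨Φ, hΦ, fun Ψ hΨ => hmax hΨ, IsGreatest.csSup_eq ⟨?_, ?_⟩, heq⟩
  · exact ⟨_, hcl, convex_candidateMenu uO Φ, hsub, hΦ.2, heq.symm⟩
  · rintro _ ⟨M, hMcl, -, hMsub, hM, rfl⟩
    exact hub M hMcl hMsub hM
end
end
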